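/- arXiv:2603.09899 — 7 statements merged into one kernel-verified Lean document; each statement's English description precedes it below -/
import Mathlib

section
/- Let N be a positive integer and M = (ZMod N)². Fix a basis (P, Q) of M. Then a pair (P', Q') ∈ M × M satisfies P' = a•P + b•Q and Q' = d•Q for some a, b, d ∈ ZMod N with a·d a unit if and only if (P', Q') is a basis of M and Q' lies in the submodule of M generated by Q. (This is the paper's claim that the Borel level structure Γ₀·(P,Q) — the orbit of the basis (P,Q) under the Borel subgroup — is exactly the set of bases (P',Q') with Q' ∈ ⟨Q⟩, so Borel structures of level N correspond to cyclic subgroups of order N.) -/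
/-- A pair `(P, Q)` of elements of `(ZMod N)²` is a basis if every element is
uniquely a combination `a•P + b•Q`. -/
def IsBasisPair (N : ℕ) (P Q : ZMod N × ZMod N) : Prop :=
  ∀ v : ZMod N × ZMod N, ∃! c : ZMod N × ZMod N, v = c.1 • P + c.2 • Q

theorem IsBasisPair.coeff_eq {N : ℕ} {P Q : ZMod N × ZMod N} (h : IsBasisPair N P Q)
    {x y x' y' : ZMod N} (e : x • P + y • Q = x' • P + y' • Q) : x = x' ∧ y = y' :=
  Prod.mk.inj ((h (x • P + y • Q)).unique (y₁ := (x, y)) (y₂ := (x', y')) rfl e)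

theorem smul_add_smul_triangular {N : ℕ} (P Q : ZMod N × ZMod N) (a b d x y : ZMod N) :
    x • (a • P + b • Q) + y • d • Q = (x * a) • P + (x * b + y * d) • Q := by
  module

theorem IsBasisPair.triangular {N : ℕ} {P Q : ZMod N × ZMod N} (h : IsBasisPair N P Q)
    {a b d : ZMod N} (had : IsUnit (a * d)) : IsBasisPair N (a • P + b • Q) (d • Q) := by
  obtain ⟨⟨u, rfl⟩, ⟨w, rfl⟩⟩ := IsUnit.mul_iff.mp had
  intro v
  obtain ⟨⟨x, y⟩, rfl, -⟩ := h v
  refine ⟨(x * ↑u⁻¹, (y - x * ↑u⁻¹ * b) * ↑w⁻¹), ?_, ?_⟩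
  · simp only [smul_add_smul_triangular]
    simp
  · rintro ⟨s, t⟩ e
    rw [smul_add_smul_triangular] at e
    obtain ⟨rfl, rfl⟩ := h.coeff_eq e
    simp

theorem IsBasisPair.isUnit_of_triangular {N : ℕ} {P Q : ZMod N × ZMod N} (h : IsBasisPair N P Q)
    {a b d : ZMod N} (h' : IsBasisPair N (a • P + b • Q) (d • Q)) : IsUnit (a * d) := by
  obtain ⟨⟨x, y⟩, hP, -⟩ := h' P
  obtain ⟨⟨s, t⟩, hQ, -⟩ := h' Q
  rw [smul_add_smul_triangular] at hP hQ
  have hxa : 1 = x * a := (h.coeff_eq (x := 1) (y := 0) (by simpa using hP)).1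
  obtain ⟨hsa, htd⟩ := h.coeff_eq (x := 0) (y := 1) (by simpa using hQ)
  have hs : s = 0 := by linear_combination s * hxa - x * hsa
  subst hs
  exact .of_mul_eq_one (x * t) (by linear_combination -hxa - x * a * htd)

/-- the Borel orbit of a basis `(P,Q)` of `(ZMod N)²` consists
exactly of the bases `(P',Q')` with `Q' ∈ ⟨Q⟩`. -/
theorem borel_orbit_eq_bases_with_Q_in_span
    (N : ℕ) (hN : 0 < N) (P Q : ZMod N × ZMod N) (hPQ : IsBasisPair N P Q)
    (P' Q' : ZMod N × ZMod N) :
    (∃ a b d : ZMod N, IsUnit (a * d) ∧ P' = a • P + b • Q ∧ Q' = d • Q) ↔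
      (IsBasisPair N P' Q' ∧ Q' ∈ Submodule.span (ZMod N) ({Q} : Set (ZMod N × ZMod N))) := by
  constructor
  · rintro ⟨a, b, d, had, rfl, rfl⟩
    exact ⟨hPQ.triangular had, Submodule.mem_span_singleton.mpr ⟨d, rfl⟩⟩
  · rintro ⟨h', hQ'⟩
    obtain ⟨d, rfl⟩ := Submodule.mem_span_singleton.mp hQ'
    obtain ⟨⟨a, b⟩, rfl, -⟩ := hPQ P'
    exact ⟨a, b, d, hPQ.isUnit_of_triangular h', rfl, rfl⟩
end

section
/- Let N be a positive integer and M = (ZMod N)². Fix a basis (P, Q) of M. Then a pair (P', Q') ∈ M × M satisfies P' = a•P and Q' = d•Q for some units a, d ∈ (ZMod N)ˣ if and only if (P', Q') is a basis of M, P' lies in the submodule of M generated by P, and Q' lies in the submodule of M generated by Q. (This is the paper's claim that split Cartan level structures correspond to ordered pairs of cyclic subgroups whose direct sum is the full N-torsion: the orbit of (P,Q) under the split Cartan subgroup is exactly the set of bases (P',Q') with P' ∈ ⟨P⟩ and Q' ∈ ⟨Q⟩.) -/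
/-- the split Cartan orbit of a basis `(P,Q)` of `(ZMod N)²` consists
exactly of the bases `(P',Q')` with `P' ∈ ⟨P⟩` and `Q' ∈ ⟨Q⟩`. -/
theorem split_cartan_orbit_eq_bases_in_spans
    (N : ℕ) (hN : 0 < N) (P Q : ZMod N × ZMod N) (hPQ : IsBasisPair N P Q)
    (P' Q' : ZMod N × ZMod N) :
    (∃ a d : (ZMod N)ˣ, P' = (a : ZMod N) • P ∧ Q' = (d : ZMod N) • Q) ↔
      (IsBasisPair N P' Q' ∧
        P' ∈ Submodule.span (ZMod N) ({P} : Set (ZMod N × ZMod N)) ∧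
        Q' ∈ Submodule.span (ZMod N) ({Q} : Set (ZMod N × ZMod N))) := by
  have coeff_eq : ∀ x y z w : ZMod N, x • P + y • Q = z • P + w • Q → x = z ∧ y = w := by
    intro x y z w h
    have := (hPQ (x • P + y • Q)).unique (y₁ := (x, y)) (y₂ := (z, w)) rfl h
    exact Prod.mk.inj this
  simp only [Submodule.mem_span_singleton]
  constructor
  · rintro ⟨a, d, rfl, rfl⟩
    refine ⟨fun v => ?_, ⟨a, rfl⟩, ⟨d, rfl⟩⟩
    obtain ⟨⟨x, y⟩, hv, -⟩ := hPQ v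
    refine ⟨(x * ↑a⁻¹, y * ↑d⁻¹), by simpa [smul_smul, mul_assoc] using hv, ?_⟩
    rintro ⟨z, w⟩ hzw
    simp only [smul_smul] at hv hzw
    obtain ⟨hx, hy⟩ := coeff_eq _ _ _ _ (hv.symm.trans hzw)
    simp [hx, hy, mul_assoc]
  · rintro ⟨h, ⟨a, rfl⟩, ⟨d, rfl⟩⟩
    obtain ⟨⟨x, y⟩, hP, -⟩ := h P
    obtain ⟨⟨z, w⟩, hQ, -⟩ := h Q
    simp only [smul_smul] at hP hQ
    have ha : x * a = 1 := (coeff_eq _ _ 1 0 (by rw [← hP]; simp)).1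
    have hd : w * d = 1 := (coeff_eq _ _ 0 1 (by rw [← hQ]; simp)).2
    exact ⟨Units.mkOfMulEqOne a x (by rw [mul_comm, ha]),
      Units.mkOfMulEqOne d w (by rw [mul_comm, hd]), rfl, rfl⟩
end

section
/- Let N be an odd positive integer. In M₂(ZMod N), the ZMod N-submodule spanned by the set of invertible upper-triangular matrices {g : g 1 0 = 0 and det g is a unit} is exactly the set of all upper-triangular matrices {g : g 1 0 = 0}. (This is the paper's claim that for the Borel subgroup Γ₀, the set ⟨Γ₀⟩ of all ZMod N-linear combinations of elements of Γ₀ equals the set of upper-triangular matrices, hence [M₂(ZMod N) : ⟨Γ₀⟩] = N.) -/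
/-- Over a commutative ring in which `2` is invertible, the span of the invertible upper-triangular
2×2 matrices is the set of all upper-triangular matrices. -/
theorem coe_span_invertible_upperTriangular {R : Type*} [CommRing R] (h2 : IsUnit (2 : R)) :
    (Submodule.span R {g : Matrix (Fin 2) (Fin 2) R | g 1 0 = 0 ∧ IsUnit g.det} :
        Set (Matrix (Fin 2) (Fin 2) R)) = {g | g 1 0 = 0} := by
  ext g
  constructor
  · intro hg
    exact Submodule.span_induction (p := fun x _ => x 1 0 = 0) (fun x hx => hx.1) rfl
      (fun x y _ _ hx hy => by simp [hx, hy]) (fun a x _ hx => by simp [hx]) hg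
  · intro hg
    obtain ⟨c, hc⟩ := h2.exists_right_inv
    have hg10 : g 1 0 = 0 := hg
    have key : g = (c * (g 0 0 + g 1 1) - g 0 1) • !![1, 0; 0, 1]
        + (c * (g 0 0 - g 1 1)) • !![1, 0; 0, -1] + g 0 1 • !![1, 1; 0, 1] := by
      ext i j
      fin_cases i <;> fin_cases j <;> simp [hg10]
      · linear_combination -(g 0 0) * hc
      · linear_combination -(g 1 1) * hc
    rw [key]
    refine add_mem (add_mem ?_ ?_) ?_ <;>
      exact Submodule.smul_mem _ _ (Submodule.subset_span (by simp [Matrix.det_fin_two]))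

/-- for odd `N`, the `ZMod N`-span of the invertible upper-triangular
2×2 matrices over `ZMod N` is the set of all upper-triangular matrices. -/
theorem span_borel_eq_upper_triangular (N : ℕ) (hN : 0 < N) (hodd : Odd N) :
    ((Submodule.span (ZMod N)
        {g : Matrix (Fin 2) (Fin 2) (ZMod N) | g 1 0 = 0 ∧ IsUnit g.det} :
        Submodule (ZMod N) (Matrix (Fin 2) (Fin 2) (ZMod N))) :
        Set (Matrix (Fin 2) (Fin 2) (ZMod N)))
      = {g : Matrix (Fin 2) (Fin 2) (ZMod N) | g 1 0 = 0} := by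
  have h2 : IsUnit ((2 : ℕ) : ZMod N) :=
    (ZMod.isUnit_iff_coprime 2 N).2 (Nat.coprime_two_left.2 hodd)
  exact coe_span_invertible_upperTriangular (by exact_mod_cast h2)
end

section
/- Let N be a positive integer, and let Γ₀(N) ≤ GL₂(ZMod N) be the Borel subgroup of invertible upper-triangular matrices. Then the index [GL₂(ZMod N) : Γ₀(N)] satisfies [GL₂(ZMod N) : Γ₀(N)] · ∏_{p ∈ N.primeFactors} p = N · ∏_{p ∈ N.primeFactors} (p + 1). (This is the size N ∏_{p|N}(1 + 1/p) of the challenge space, i.e., the inverse of the knowledge error ε = [GL₂ : Γ]⁻¹, for Borel level structures.) -/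
/-- The Borel subgroup of `GL₂(ZMod N)`: invertible upper-triangular matrices. -/
def BorelSubgroup (N : ℕ) : Subgroup (Matrix.GeneralLinearGroup (Fin 2) (ZMod N)) where
  carrier := {g | (g : Matrix (Fin 2) (Fin 2) (ZMod N)) 1 0 = 0}
  one_mem' := by
    show ((1 : Matrix.GeneralLinearGroup (Fin 2) (ZMod N)) : Matrix (Fin 2) (Fin 2) (ZMod N)) 1 0 = 0
    simp [Matrix.one_apply]
  mul_mem' := by
    intro x y hx hy
    have hx' : (x : Matrix (Fin 2) (Fin 2) (ZMod N)) 1 0 = 0 := hx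
    have hy' : (y : Matrix (Fin 2) (Fin 2) (ZMod N)) 1 0 = 0 := hy
    show ((x * y : Matrix.GeneralLinearGroup (Fin 2) (ZMod N)) : Matrix (Fin 2) (Fin 2) (ZMod N)) 1 0 = 0
    have h : ((x * y : Matrix.GeneralLinearGroup (Fin 2) (ZMod N)) : Matrix (Fin 2) (Fin 2) (ZMod N))
        = (x : Matrix (Fin 2) (Fin 2) (ZMod N)) * (y : Matrix (Fin 2) (Fin 2) (ZMod N)) := rfl
    rw [h, Matrix.mul_apply, Fin.sum_univ_two, hx', hy']
    ring
  inv_mem' := by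
    intro g hg
    have hg' : (g : Matrix (Fin 2) (Fin 2) (ZMod N)) 1 0 = 0 := hg
    show ((g⁻¹ : Matrix.GeneralLinearGroup (Fin 2) (ZMod N)) : Matrix (Fin 2) (Fin 2) (ZMod N)) 1 0 = 0
    set A := (g : Matrix (Fin 2) (Fin 2) (ZMod N)) with hA
    set B := ((g⁻¹ : Matrix.GeneralLinearGroup (Fin 2) (ZMod N)) : Matrix (Fin 2) (Fin 2) (ZMod N)) with hB
    have hBA : B * A = 1 := congrArg Units.val (inv_mul_cancel g)
    have hdet : IsUnit A.det := (Matrix.isUnit_iff_isUnit_det A).mp ⟨g, rfl⟩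
    have hA00 : IsUnit (A 0 0) := by
      have h2 : A.det = A 0 0 * A 1 1 := by
        rw [Matrix.det_fin_two, hg']; ring
      rw [h2] at hdet
      exact isUnit_of_mul_isUnit_left hdet
    have h0 : B 1 0 * A 0 0 = 0 := by
      have h3 := congrFun (congrFun hBA 1) 0
      rw [Matrix.mul_apply, Fin.sum_univ_two, hg'] at h3
      simpa [Matrix.one_apply] using h3
    exact (hA00.mul_left_eq_zero).mp h0

open Matrix in
theorem mem_borelSubgroup {N : ℕ} {g : GeneralLinearGroup (Fin 2) (ZMod N)} :
    g ∈ BorelSubgroup N ↔ g 1 0 = 0 :=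
  Iff.rfl

open Matrix in
/-- Two matrices lie in the same left coset of the Borel subgroup exactly when their first columns
are proportional. -/
theorem inv_mul_mem_borelSubgroup {N : ℕ} (g h : GeneralLinearGroup (Fin 2) (ZMod N)) :
    g⁻¹ * h ∈ BorelSubgroup N ↔ g 0 0 * h 1 0 = g 1 0 * h 0 0 := by
  have hdet : IsUnit (g : Matrix (Fin 2) (Fin 2) (ZMod N)).det :=
    (isUnit_iff_isUnit_det _).mp g.isUnit
  have entry : (g⁻¹ * h : GeneralLinearGroup (Fin 2) (ZMod N)) 1 0 =
      Ring.inverse (g : Matrix (Fin 2) (Fin 2) (ZMod N)).det *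
        (g 0 0 * h 1 0 - g 1 0 * h 0 0) := by
    rw [GeneralLinearGroup.coe_mul, GeneralLinearGroup.coe_inv, inv_def, adjugate_fin_two,
      Matrix.mul_apply, Fin.sum_univ_two]
    simp
    ring
  rw [mem_borelSubgroup, entry, (hdet.ringInverse).mul_right_eq_zero, sub_eq_zero]

theorem ZMod.isLocalRing_prime_pow {p k : ℕ} (hp : p.Prime) (hk : k ≠ 0) :
    IsLocalRing (ZMod (p ^ k)) := by
  have : Fact p.Prime := ⟨hp⟩
  have : NeZero (p ^ k) := ⟨pow_ne_zero k hp.ne_zero⟩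
  have : IsLocalHom (ZMod.castHom (dvd_pow_self p hk) (ZMod p)) := by
    refine ⟨fun a ha => ?_⟩
    obtain ⟨n, rfl⟩ := ZMod.natCast_zmod_surjective a
    rw [map_natCast, ZMod.isUnit_iff_coprime] at ha
    exact (ZMod.isUnit_iff_coprime _ _).mpr (ha.pow_right k)
  exact RingHom.domain_isLocalRing (ZMod.castHom (dvd_pow_self p hk) (ZMod p))

open Matrix in
/-- Over a local ring, the projective line consists of the points `(x : 1)` and the points
`(1 : y)` with `y` a nonunit. -/
theorem index_borelSubgroup_of_isLocalRing (N : ℕ) [NeZero N] [IsLocalRing (ZMod N)] :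
    (BorelSubgroup N).index = N + Nat.card (nonunits (ZMod N)) := by
  let affine (x : ZMod N) : GeneralLinearGroup (Fin 2) (ZMod N) :=
    GeneralLinearGroup.mk'' !![x, -1; 1, 0] (by simp [det_fin_two])
  let infinite (y : ZMod N) : GeneralLinearGroup (Fin 2) (ZMod N) :=
    GeneralLinearGroup.mk'' !![1, 0; y, 1] (by simp [det_fin_two])
  have affine_col (x : ZMod N) : affine x 0 0 = x ∧ affine x 1 0 = 1 := ⟨rfl, rfl⟩
  have infinite_col (y : ZMod N) : infinite y 0 0 = 1 ∧ infinite y 1 0 = y := ⟨rfl, rfl⟩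
  let point : ZMod N ⊕ nonunits (ZMod N) →
      GeneralLinearGroup (Fin 2) (ZMod N) ⧸ BorelSubgroup N :=
    Sum.elim (fun x => (affine x : _ ⧸ BorelSubgroup N))
      (fun y => (infinite y : _ ⧸ BorelSubgroup N))
  have injective : Function.Injective point := by
    rintro (x | ⟨x, hx⟩) (y | ⟨y, hy⟩) h <;>
      simp only [point, Sum.elim_inl, Sum.elim_inr, QuotientGroup.eq, inv_mul_mem_borelSubgroup,
        affine_col, infinite_col, mul_one, one_mul] at h
    · rw [h]
    · exact absurd (IsUnit.of_mul_eq_one_right x h) hy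
    · exact absurd (IsUnit.of_mul_eq_one y h.symm) hx
    · simp only [h]
  have surjective : Function.Surjective point := by
    intro q
    obtain ⟨g, rfl⟩ := QuotientGroup.mk_surjective q
    by_cases hc : IsUnit (g 1 0)
    · obtain ⟨c, hc⟩ := hc
      refine ⟨Sum.inl (g 0 0 * ↑c⁻¹), ?_⟩
      simp only [point, Sum.elim_inl, QuotientGroup.eq, inv_mul_mem_borelSubgroup, affine_col]
      rw [← hc, mul_assoc, Units.inv_mul, mul_one, one_mul]
    · have hdet : IsUnit (g : Matrix (Fin 2) (Fin 2) (ZMod N)).det :=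
        (isUnit_iff_isUnit_det _).mp g.isUnit
      have ha : IsUnit (g 0 0) := by
        rw [det_fin_two, sub_eq_add_neg] at hdet
        rcases IsLocalRing.isUnit_or_isUnit_of_isUnit_add hdet with h | h
        · exact isUnit_of_mul_isUnit_left h
        · exact absurd (isUnit_of_mul_isUnit_right ((IsUnit.neg_iff _).mp h)) hc
      obtain ⟨a, ha⟩ := ha
      refine ⟨Sum.inr ⟨g 1 0 * ↑a⁻¹, fun h => hc (isUnit_of_mul_isUnit_left h)⟩, ?_⟩
      simp only [point, Sum.elim_inr, QuotientGroup.eq, inv_mul_mem_borelSubgroup, infinite_col]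
      rw [← ha, mul_assoc, Units.inv_mul, mul_one, one_mul]
  rw [Subgroup.index, ← Nat.card_congr (Equiv.ofBijective point ⟨injective, surjective⟩),
    Nat.card_sum, Nat.card_zmod]

theorem ZMod.card_nonunits_add_totient (N : ℕ) [NeZero N] :
    Nat.card (nonunits (ZMod N)) + N.totient = N := by
  classical
  have units : Nat.card {x : ZMod N // IsUnit x} = N.totient := by
    rw [← ZMod.card_units_eq_totient, ← Nat.card_eq_fintype_card]
    exact Nat.card_range_of_injective (Units.val_injective (α := ZMod N))
  rw [← units, add_comm, ← Nat.card_sum]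
  exact (Nat.card_congr (Equiv.sumCompl (fun x : ZMod N => IsUnit x))).trans (Nat.card_zmod N)

theorem index_borelSubgroup_prime_pow {p k : ℕ} (hp : p.Prime) (hk : k ≠ 0) :
    (BorelSubgroup (p ^ k)).index * p = p ^ k * (p + 1) := by
  have : NeZero (p ^ k) := ⟨pow_ne_zero k hp.ne_zero⟩
  have := ZMod.isLocalRing_prime_pow hp hk
  obtain ⟨j, rfl⟩ := Nat.exists_eq_add_one_of_ne_zero hk
  obtain ⟨r, rfl⟩ := Nat.exists_eq_add_one_of_ne_zero hp.ne_zero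
  have h := ZMod.card_nonunits_add_totient ((r + 1) ^ (j + 1))
  rw [Nat.totient_prime_pow_succ hp, Nat.add_sub_cancel, pow_succ] at h
  have card : Nat.card (nonunits (ZMod ((r + 1) ^ (j + 1)))) = (r + 1) ^ j := by
    rw [pow_succ]
    linarith
  rw [index_borelSubgroup_of_isLocalRing, card]
  ring

open Matrix in
/-- The Chinese remainder theorem for `GL₂`. -/
theorem exists_map_castHom_eq {m n : ℕ} (hmn : m.Coprime n)
    (g : GeneralLinearGroup (Fin 2) (ZMod m)) (h : GeneralLinearGroup (Fin 2) (ZMod n)) :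
    ∃ f : GeneralLinearGroup (Fin 2) (ZMod (m * n)),
      GeneralLinearGroup.map (ZMod.castHom (dvd_mul_right m n) (ZMod m)) f = g ∧
      GeneralLinearGroup.map (ZMod.castHom (dvd_mul_left n m) (ZMod n)) f = h := by
  let e := ZMod.chineseRemainder hmn
  have fst_eq : (RingHom.fst (ZMod m) (ZMod n)).comp (e : ZMod (m * n) →+* ZMod m × ZMod n) =
      ZMod.castHom (dvd_mul_right m n) (ZMod m) := Subsingleton.elim _ _
  have snd_eq : (RingHom.snd (ZMod m) (ZMod n)).comp (e : ZMod (m * n) →+* ZMod m × ZMod n) =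
      ZMod.castHom (dvd_mul_left n m) (ZMod n) := Subsingleton.elim _ _
  let A : Matrix (Fin 2) (Fin 2) (ZMod (m * n)) := of fun i j => e.symm (g i j, h i j)
  have hdet : IsUnit A.det := by
    have det_eq : e A.det = ((g : Matrix (Fin 2) (Fin 2) (ZMod m)).det,
        (h : Matrix (Fin 2) (Fin 2) (ZMod n)).det) := by
      simp [A, det_fin_two]
    rw [← isUnit_map_iff e, det_eq, Prod.isUnit_iff]
    exact ⟨(isUnit_iff_isUnit_det _).mp g.isUnit, (isUnit_iff_isUnit_det _).mp h.isUnit⟩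
  refine ⟨GeneralLinearGroup.mk'' A hdet, ?_, ?_⟩
  · rw [← fst_eq]
    ext i j
    exact congrArg Prod.fst (e.apply_symm_apply (g i j, h i j))
  · rw [← snd_eq]
    ext i j
    exact congrArg Prod.snd (e.apply_symm_apply (g i j, h i j))

open Matrix in
theorem index_borelSubgroup_mul {m n : ℕ} (hmn : m.Coprime n) :
    (BorelSubgroup (m * n)).index = (BorelSubgroup m).index * (BorelSubgroup n).index := by
  let reduce : GeneralLinearGroup (Fin 2) (ZMod (m * n)) →*
      GeneralLinearGroup (Fin 2) (ZMod m) × GeneralLinearGroup (Fin 2) (ZMod n) :=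
    (GeneralLinearGroup.map (ZMod.castHom (dvd_mul_right m n) (ZMod m))).prod
      (GeneralLinearGroup.map (ZMod.castHom (dvd_mul_left n m) (ZMod n)))
  have surjective : Function.Surjective reduce := by
    rintro ⟨g, h⟩
    obtain ⟨f, hg, hh⟩ := exists_map_castHom_eq hmn g h
    exact ⟨f, Prod.ext hg hh⟩
  have comap_eq : BorelSubgroup (m * n) =
      ((BorelSubgroup m).prod (BorelSubgroup n)).comap reduce := by
    ext g
    let e := ZMod.chineseRemainder hmn
    have e_apply (x : ZMod (m * n)) : e x = (ZMod.castHom (dvd_mul_right m n) (ZMod m) x,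
        ZMod.castHom (dvd_mul_left n m) (ZMod n) x) :=
      congrFun (congrArg DFunLike.coe (Subsingleton.elim (e : ZMod (m * n) →+* ZMod m × ZMod n)
        ((ZMod.castHom (dvd_mul_right m n) (ZMod m)).prod
          (ZMod.castHom (dvd_mul_left n m) (ZMod n))))) x
    rw [Subgroup.mem_comap, Subgroup.mem_prod, mem_borelSubgroup, mem_borelSubgroup,
      mem_borelSubgroup, ← e.map_eq_zero_iff, e_apply, Prod.mk_eq_zero]
    rfl
  rw [comap_eq, Subgroup.index_comap_of_surjective _ surjective, Subgroup.index_prod]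

/-- `[GL₂(ZMod N) : Γ₀(N)] · ∏_{p|N} p = N · ∏_{p|N} (p + 1)`. -/
theorem index_borel (N : ℕ) (hN : 0 < N) :
    (BorelSubgroup N).index * ∏ p ∈ N.primeFactors, p
      = N * ∏ p ∈ N.primeFactors, (p + 1) := by
  induction N using Nat.recOnPosPrimePosCoprime with
  | zero => exact absurd hN (lt_irrefl 0)
  | one =>
    have : BorelSubgroup 1 = ⊤ := eq_top_iff.mpr fun g _ => Subsingleton.elim (α := ZMod 1) _ _
    simp [this]
  | prime_pow p k hp hk =>
    simpa [Nat.primeFactors_prime_pow hk.ne' hp] using index_borelSubgroup_prime_pow hp hk.ne'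
  | coprime m n hm hn hmn ihm ihn =>
    rw [hmn.primeFactors_mul, Finset.prod_union hmn.disjoint_primeFactors,
      Finset.prod_union hmn.disjoint_primeFactors, index_borelSubgroup_mul hmn,
      mul_mul_mul_comm, ihm (by omega), ihn (by omega), mul_mul_mul_comm]
end

section
/- Let N be a positive integer, and let Z(N) ≤ GL₂(ZMod N) be the scalar subgroup {λ·1 : λ ∈ (ZMod N)ˣ}. Then the index [GL₂(ZMod N) : Z(N)] satisfies [GL₂(ZMod N) : Z(N)] · ∏_{p ∈ N.primeFactors} p² = N³ · ∏_{p ∈ N.primeFactors} (p² − 1). (This is the size N³ ∏_{p|N}(1 − 1/p²) of the challenge space, i.e., the inverse of the knowledge error ε = [GL₂ : Γ]⁻¹, for scalar level structures.) -/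
/-- The scalar subgroup `Z(N) = {λ·1 : λ ∈ (ZMod N)ˣ}` of `GL₂(ZMod N)`. -/
def ScalarSubgroup (N : ℕ) : Subgroup (Matrix.GeneralLinearGroup (Fin 2) (ZMod N)) where
  carrier := {g | ∃ lam : (ZMod N)ˣ,
    (g : Matrix (Fin 2) (Fin 2) (ZMod N)) = (lam : ZMod N) • (1 : Matrix (Fin 2) (Fin 2) (ZMod N))}
  one_mem' := ⟨1, by simp⟩
  mul_mem' := by
    rintro x y ⟨lam, hx⟩ ⟨mu, hy⟩
    refine ⟨lam * mu, ?_⟩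
    have h : ((x * y : Matrix.GeneralLinearGroup (Fin 2) (ZMod N)) : Matrix (Fin 2) (Fin 2) (ZMod N))
        = (x : Matrix (Fin 2) (Fin 2) (ZMod N)) * (y : Matrix (Fin 2) (Fin 2) (ZMod N)) := rfl
    rw [h, hx, hy, smul_mul_smul_comm]
    simp
  inv_mem' := by
    rintro g ⟨lam, hg⟩
    refine ⟨lam⁻¹, ?_⟩
    have h1 : (g : Matrix (Fin 2) (Fin 2) (ZMod N)) *
        (((lam⁻¹ : (ZMod N)ˣ) : ZMod N) • (1 : Matrix (Fin 2) (Fin 2) (ZMod N))) = 1 := by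
      rw [hg, smul_mul_smul_comm]
      simp
    exact Units.inv_eq_of_mul_eq_one_right h1

theorem card_scalarSubgroup (N : ℕ) [NeZero N] : Nat.card (ScalarSubgroup N) = N.totient := by
  rw [← ZMod.card_units_eq_totient, ← Nat.card_eq_fintype_card]
  have key : ∀ lam : (ZMod N)ˣ,
      ((Units.map (Matrix.scalar (Fin 2) : ZMod N →+* _).toMonoidHom lam :
        Matrix.GeneralLinearGroup (Fin 2) (ZMod N)) : Matrix (Fin 2) (Fin 2) (ZMod N))
        = (lam : ZMod N) • 1 := by
    intro lam
    simp [Matrix.smul_one_eq_diagonal]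
  refine (Nat.card_congr (Equiv.ofBijective
    (fun lam : (ZMod N)ˣ =>
      (⟨Units.map (Matrix.scalar (Fin 2) : ZMod N →+* _).toMonoidHom lam, lam, key lam⟩ :
        ScalarSubgroup N)) ⟨?_, ?_⟩)).symm
  · intro a b h
    have h' := congrArg (fun g : ScalarSubgroup N =>
      ((g : Matrix.GeneralLinearGroup (Fin 2) (ZMod N)) :
        Matrix (Fin 2) (Fin 2) (ZMod N)) 0 0) h
    ext
    simpa using h'
  · rintro ⟨g, lam, hg⟩
    exact ⟨lam, Subtype.ext (Units.ext ((key lam).trans hg.symm))⟩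

theorem card_GL_two_mul_of_coprime {a b : ℕ} (h : a.Coprime b) :
    Nat.card (Matrix.GeneralLinearGroup (Fin 2) (ZMod (a * b))) =
      Nat.card (Matrix.GeneralLinearGroup (Fin 2) (ZMod a)) *
        Nat.card (Matrix.GeneralLinearGroup (Fin 2) (ZMod b)) := by
  let f : Matrix (Fin 2) (Fin 2) (ZMod a × ZMod b) →+*
      Matrix (Fin 2) (Fin 2) (ZMod a) × Matrix (Fin 2) (Fin 2) (ZMod b) :=
    (RingHom.fst _ _).mapMatrix.prod (RingHom.snd _ _).mapMatrix
  have hf : Function.Bijective f := by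
    refine ⟨fun A B hAB => ?_, fun ⟨A, B⟩ => ⟨Matrix.of fun i j => (A i j, B i j), rfl⟩⟩
    ext i j
    · exact congrFun₂ (congrArg Prod.fst hAB) i j
    · exact congrFun₂ (congrArg Prod.snd hAB) i j
  let e := (ZMod.chineseRemainder h).mapMatrix (m := Fin 2) |>.trans (RingEquiv.ofBijective f hf)
  rw [← Nat.card_prod]
  exact Nat.card_congr ((Units.mapEquiv e.toMulEquiv).trans MulEquiv.prodUnits).toEquiv

/-- The preimage of a set under a surjective homomorphism of finite groups has the same
density as the set itself. -/
theorem AddMonoidHom.card_preimage_mul_card {G H : Type*} [AddGroup G] [AddGroup H] [Finite G]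
    [Finite H] (f : G →+ H) (hf : Function.Surjective f) (P : H → Prop) :
    Nat.card {g // P (f g)} * Nat.card H = Nat.card G * Nat.card {h // P h} := by
  classical
  have := Fintype.ofFinite G
  have := Fintype.ofFinite H
  have fiber : ∀ y : H, (Finset.univ.filter fun g => f g = y).card =
      (Finset.univ.filter fun g => f g = 0).card := fun y =>
    AddMonoidHom.card_fiber_eq_of_mem_range f (hf y) (hf 0)
  have hP : ∀ Q : H → Prop, Nat.card {g // Q (f g)} =
      Nat.card {h // Q h} * (Finset.univ.filter fun g => f g = 0).card := by
    intro Q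
    rw [Nat.card_eq_fintype_card, Nat.card_eq_fintype_card, Fintype.card_subtype,
      Fintype.card_subtype, Finset.card_eq_sum_card_fiberwise (f := f)
        (t := Finset.univ.filter Q) (fun g hg => by simpa using hg), ← smul_eq_mul,
      ← Finset.sum_const]
    refine Finset.sum_congr rfl fun y hy => ?_
    rw [← fiber y, Finset.filter_filter]
    congr 1
    ext g
    simp only [Finset.mem_filter, Finset.mem_univ, true_and] at hy ⊢
    exact ⟨fun h => h.2, fun h => ⟨h ▸ hy, h⟩⟩
  have hG : Nat.card G = Nat.card H * (Finset.univ.filter fun g => f g = 0).card := by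
    have := hP fun _ => True
    rwa [Nat.card_congr (Equiv.subtypeUnivEquiv fun _ => trivial),
      Nat.card_congr (Equiv.subtypeUnivEquiv fun _ => trivial)] at this
  rw [hP P, hG]
  ring

theorem ZMod.isUnit_castHom_prime_pow_iff {p k : ℕ} (hp : p.Prime) (hk : k ≠ 0)
    (x : ZMod (p ^ k)) : IsUnit (ZMod.castHom (dvd_pow_self p hk) (ZMod p) x) ↔ IsUnit x := by
  have : NeZero (p ^ k) := ⟨pow_ne_zero _ hp.ne_zero⟩
  obtain ⟨n, rfl⟩ := ZMod.natCast_zmod_surjective x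
  rw [map_natCast, ZMod.isUnit_iff_coprime, ZMod.isUnit_iff_coprime,
    Nat.coprime_pow_right_iff (Nat.pos_of_ne_zero hk)]

theorem card_GL_two_prime_pow {p k : ℕ} (hp : p.Prime) (hk : k ≠ 0) :
    Nat.card (Matrix.GeneralLinearGroup (Fin 2) (ZMod (p ^ k))) * p ^ 3 =
      (p ^ k) ^ 4 * ((p ^ 2 - 1) * (p - 1)) := by
  have : Fact p.Prime := ⟨hp⟩
  have : NeZero (p ^ k) := ⟨pow_ne_zero _ hp.ne_zero⟩
  let c := ZMod.castHom (dvd_pow_self p hk) (ZMod p)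
  let f := c.mapMatrix (m := Fin 2)
  have hf : Function.Surjective f := by
    intro B
    choose A hA using fun i j => ZMod.castHom_surjective (dvd_pow_self p hk) (B i j)
    exact ⟨Matrix.of A, Matrix.ext hA⟩
  have hunit : ∀ A, IsUnit (f A) ↔ IsUnit A := fun A => by
    rw [Matrix.isUnit_iff_isUnit_det, Matrix.isUnit_iff_isUnit_det, ← RingHom.map_det]
    exact ZMod.isUnit_castHom_prime_pow_iff hp hk _
  have hcard := AddMonoidHom.card_preimage_mul_card f.toAddMonoidHom hf IsUnit
  have hsource : Nat.card (Matrix.GeneralLinearGroup (Fin 2) (ZMod (p ^ k))) =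
      Nat.card {A // IsUnit (f.toAddMonoidHom A)} :=
    Nat.card_congr (Submonoid.unitsTypeEquivIsUnitSubmonoid.toEquiv.trans
      (Equiv.subtypeEquivRight fun A => (hunit A).symm))
  have htarget : Nat.card {B : Matrix (Fin 2) (Fin 2) (ZMod p) // IsUnit B} =
      (p ^ 2 - 1) * (p ^ 2 - p) := by
    have hunits : Nat.card (Matrix.GeneralLinearGroup (Fin 2) (ZMod p)) =
        Nat.card {B : Matrix (Fin 2) (Fin 2) (ZMod p) // IsUnit B} :=
      Nat.card_congr Submonoid.unitsTypeEquivIsUnitSubmonoid.toEquiv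
    rw [← hunits]
    simpa [Fin.prod_univ_two] using Matrix.card_GL_field (𝔽 := ZMod p) 2
  have hmat : ∀ n : ℕ, Nat.card (Matrix (Fin 2) (Fin 2) (ZMod n)) = n ^ 4 := fun n => by
    simp only [Matrix, Nat.card_fun, Nat.card_zmod, Nat.card_eq_fintype_card, Fintype.card_fin]
    ring
  rw [← hsource, htarget, hmat, hmat] at hcard
  have hsq : p ^ 2 - p = p * (p - 1) := by rw [Nat.mul_sub, mul_one, sq]
  rw [hsq] at hcard
  apply Nat.eq_of_mul_eq_mul_right hp.pos
  linear_combination hcard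

theorem card_GL_two_zmod (N : ℕ) (hN : N ≠ 0) :
    Nat.card (Matrix.GeneralLinearGroup (Fin 2) (ZMod N)) * ∏ p ∈ N.primeFactors, p ^ 3 =
      N ^ 4 * ∏ p ∈ N.primeFactors, ((p ^ 2 - 1) * (p - 1)) := by
  induction N using Nat.recOnPosPrimePosCoprime with
  | zero => exact absurd rfl hN
  | one =>
    have : Subsingleton (Matrix.GeneralLinearGroup (Fin 2) (ZMod 1)) :=
      ⟨fun _ _ => Units.ext (Subsingleton.elim _ _)⟩
    simp
  | prime_pow p k hp hk =>
    rw [Nat.primeFactors_prime_pow hk.ne' hp, Finset.prod_singleton, Finset.prod_singleton]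
    exact card_GL_two_prime_pow hp hk.ne'
  | coprime a b ha hb hab iha ihb =>
    rw [card_GL_two_mul_of_coprime hab, hab.primeFactors_mul,
      Finset.prod_union hab.disjoint_primeFactors, Finset.prod_union hab.disjoint_primeFactors,
      mul_mul_mul_comm, iha (by omega), ihb (by omega)]
    ring

/-- `[GL₂(ZMod N) : Z(N)] · ∏_{p|N} p² = N³ · ∏_{p|N} (p² − 1)`. -/
theorem index_scalar_subgroup (N : ℕ) (hN : 0 < N) :
    (ScalarSubgroup N).index * ∏ p ∈ N.primeFactors, p ^ 2
      = N ^ 3 * ∏ p ∈ N.primeFactors, (p ^ 2 - 1) := by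
  have : NeZero N := ⟨hN.ne'⟩
  have hindex := (ScalarSubgroup N).card_mul_index
  rw [card_scalarSubgroup] at hindex
  have hGL := card_GL_two_zmod N hN.ne'
  have htot := Nat.totient_mul_prod_primeFactors N
  rw [← hindex, Finset.prod_mul_distrib, Finset.prod_pow] at hGL
  rw [Finset.prod_pow]
  have hpos : 0 < N * ∏ p ∈ N.primeFactors, (p - 1) :=
    Nat.mul_pos hN (Finset.prod_pos fun p hp =>
      Nat.sub_pos_of_lt (Nat.prime_of_mem_primeFactors hp).one_lt)
  apply Nat.eq_of_mul_eq_mul_left hpos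
  rw [← htot]
  calc _ = N.totient * (ScalarSubgroup N).index * (∏ p ∈ N.primeFactors, p) ^ 3 := by ring
    _ = N ^ 3 * (∏ p ∈ N.primeFactors, (p ^ 2 - 1)) *
        (N * ∏ p ∈ N.primeFactors, (p - 1)) := by rw [hGL]; ring
    _ = _ := by rw [← htot]; ring
end

section
/- Let N be a positive integer, and let C(N) ≤ GL₂(ZMod N) be the split Cartan subgroup of invertible diagonal matrices. Then the index [GL₂(ZMod N) : C(N)] satisfies [GL₂(ZMod N) : C(N)] · ∏_{p ∈ N.primeFactors} p = N² · ∏_{p ∈ N.primeFactors} (p + 1). (This is the size N² ∏_{p|N}(1 + 1/p) of the challenge space, i.e., the inverse of the knowledge error ε = [GL₂ : Γ]⁻¹, for split Cartan level structures.) -/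
/-- The split Cartan subgroup of `GL₂(ZMod N)`: invertible diagonal matrices. -/
def SplitCartanSubgroup (N : ℕ) : Subgroup (Matrix.GeneralLinearGroup (Fin 2) (ZMod N)) where
  carrier := {g | (g : Matrix (Fin 2) (Fin 2) (ZMod N)) 0 1 = 0 ∧
    (g : Matrix (Fin 2) (Fin 2) (ZMod N)) 1 0 = 0}
  one_mem' := by
    constructor <;> simp [Matrix.one_apply]
  mul_mem' := by
    rintro x y ⟨hx1, hx2⟩ ⟨hy1, hy2⟩
    have h : ((x * y : Matrix.GeneralLinearGroup (Fin 2) (ZMod N)) : Matrix (Fin 2) (Fin 2) (ZMod N))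
        = (x : Matrix (Fin 2) (Fin 2) (ZMod N)) * (y : Matrix (Fin 2) (Fin 2) (ZMod N)) := rfl
    constructor <;>
    · show ((x * y : Matrix.GeneralLinearGroup (Fin 2) (ZMod N)) : Matrix (Fin 2) (Fin 2) (ZMod N)) _ _ = 0
      rw [h, Matrix.mul_apply, Fin.sum_univ_two]
      simp [hx1, hx2, hy1, hy2]
  inv_mem' := by
    rintro g ⟨hg1, hg2⟩
    set A := (g : Matrix (Fin 2) (Fin 2) (ZMod N)) with hA
    set B := ((g⁻¹ : Matrix.GeneralLinearGroup (Fin 2) (ZMod N)) : Matrix (Fin 2) (Fin 2) (ZMod N)) with hB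
    have hBA : B * A = 1 := congrArg Units.val (inv_mul_cancel g)
    have hdet : IsUnit A.det := (Matrix.isUnit_iff_isUnit_det A).mp ⟨g, rfl⟩
    have hdet2 : A.det = A 0 0 * A 1 1 := by
      rw [Matrix.det_fin_two, hg1, hg2]; ring
    have hA00 : IsUnit (A 0 0) := isUnit_of_mul_isUnit_left (hdet2 ▸ hdet)
    have hA11 : IsUnit (A 1 1) := isUnit_of_mul_isUnit_right (hdet2 ▸ hdet)
    constructor
    · show B 0 1 = 0
      have h3 := congrFun (congrFun hBA 0) 1
      rw [Matrix.mul_apply, Fin.sum_univ_two, hg1] at h3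
      simp only [Matrix.one_apply, mul_zero, zero_add] at h3
      have h4 : B 0 1 * A 1 1 = 0 := by simpa using h3
      exact hA11.mul_left_eq_zero.mp h4
    · show B 1 0 = 0
      have h3 := congrFun (congrFun hBA 1) 0
      rw [Matrix.mul_apply, Fin.sum_univ_two, hg2] at h3
      simp only [Matrix.one_apply, mul_zero, add_zero] at h3
      have h4 : B 1 0 * A 0 0 = 0 := by simpa using h3
      exact hA00.mul_left_eq_zero.mp h4

/-- For a surjective local homomorphism of finite rings, the unit groups are in the same ratio as
the rings. -/
theorem Nat.card_units_mul_card_of_surjective {A B : Type*} [Ring A] [Ring B] [Finite A]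
    (f : A →+* B) (hf : Function.Surjective f) [IsLocalHom f] :
    Nat.card Aˣ * Nat.card B = Nat.card Bˣ * Nat.card A := by
  have hsurj : Function.Surjective (Units.map (f : A →* B)) := by
    intro u
    obtain ⟨a, ha⟩ := hf u
    have hu : IsUnit a := isUnit_of_map_unit f a (ha ▸ u.isUnit)
    exact ⟨hu.unit, Units.ext ha⟩
  have e : (Units.map (f : A →* B)).ker ≃ (f : A →+ B).ker :=
    { toFun := fun u => ⟨(u : Aˣ) - 1, by
        have h : f ((u : Aˣ) : A) = 1 := congrArg Units.val u.2
        simp [AddMonoidHom.mem_ker, h]⟩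
      invFun := fun x =>
        have h : f ((x : A) + 1) = 1 := by
          have hx : f (x : A) = 0 := x.2
          simp [hx]
        ⟨(isUnit_of_map_unit f ((x : A) + 1) (h ▸ isUnit_one)).unit, Units.ext h⟩
      left_inv := fun u => Subtype.ext (Units.ext (by simp))
      right_inv := fun x => Subtype.ext (by simp) }
  have h₁ := (Units.map (f : A →* B)).ker.card_mul_index
  have h₂ := (f : A →+ B).ker.card_mul_index
  rw [Subgroup.index_ker, MonoidHom.range_eq_top.mpr hsurj, Subgroup.card_top] at h₁
  rw [AddSubgroup.index_ker, AddMonoidHom.range_eq_top.mpr hf, AddSubgroup.card_top] at h₂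
  rw [← h₁, ← h₂, Nat.card_congr e]
  ring

/-- The general linear group of a product of rings is the product of the general linear groups. -/
theorem Matrix.GeneralLinearGroup.card_prod (n : Type*) [Fintype n] [DecidableEq n]
    (R S : Type*) [CommRing R] [CommRing S] :
    Nat.card (GL n (R × S)) = Nat.card (GL n R) * Nat.card (GL n S) := by
  have h : Function.Bijective
      ((RingHom.fst R S).mapMatrix.prod (RingHom.snd R S).mapMatrix :
        Matrix n n (R × S) →+* Matrix n n R × Matrix n n S) := by
    refine ⟨fun M M' hM => ?_, fun M => ⟨.of fun i j => (M.1 i j, M.2 i j), rfl⟩⟩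
    ext i j
    · exact congrFun (congrFun (congrArg Prod.fst hM) i) j
    · exact congrFun (congrFun (congrArg Prod.snd hM) i) j
  rw [← Nat.card_prod]
  exact Nat.card_congr
    ((Units.mapEquiv (RingEquiv.ofBijective _ h).toMulEquiv).trans MulEquiv.prodUnits).toEquiv

theorem Matrix.GeneralLinearGroup.card_zmod_mul (n : Type*) [Fintype n] [DecidableEq n]
    {a b : ℕ} (hab : a.Coprime b) :
    Nat.card (GL n (ZMod (a * b))) = Nat.card (GL n (ZMod a)) * Nat.card (GL n (ZMod b)) := by
  rw [← card_prod]
  exact Nat.card_congr (Units.mapEquiv (ZMod.chineseRemainder hab).mapMatrix.toMulEquiv).toEquiv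

theorem ZMod.isLocalHom_castHom_prime_pow {p k : ℕ} (hp : p.Prime) (hk : 0 < k) :
    IsLocalHom (ZMod.castHom (dvd_pow_self p hk.ne') (ZMod p)) := by
  refine ⟨fun x hx => ?_⟩
  have : NeZero (p ^ k) := ⟨pow_ne_zero _ hp.ne_zero⟩
  obtain ⟨a, rfl⟩ := ZMod.natCast_zmod_surjective x
  rw [map_natCast, ZMod.isUnit_iff_coprime] at hx
  exact (ZMod.isUnit_iff_coprime _ _).mpr (hx.pow_right k)

theorem Matrix.GeneralLinearGroup.card_zmod_prime_pow {p k : ℕ} (hp : p.Prime) (hk : 0 < k) :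
    Nat.card (GL (Fin 2) (ZMod (p ^ k))) * p = ((p ^ k).totient * p ^ k) ^ 2 * (p + 1) := by
  have : NeZero (p ^ k) := ⟨pow_ne_zero _ hp.ne_zero⟩
  have : Fact p.Prime := ⟨hp⟩
  let f := ZMod.castHom (dvd_pow_self p hk.ne') (ZMod p)
  have : IsLocalHom f := ZMod.isLocalHom_castHom_prime_pow hp hk
  have hloc : IsLocalHom (f.mapMatrix (m := Fin 2)) := by
    refine ⟨fun M hM => ?_⟩
    rw [Matrix.isUnit_iff_isUnit_det, ← RingHom.map_det] at hM
    exact (Matrix.isUnit_iff_isUnit_det M).mpr (isUnit_of_map_unit f _ hM)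
  have hsurj : Function.Surjective (f.mapMatrix (m := Fin 2)) := by
    intro M
    choose g hg using ZMod.castHom_surjective (dvd_pow_self p hk.ne')
    exact ⟨M.map g, by ext i j; exact hg _⟩
  have h := Nat.card_units_mul_card_of_surjective (f.mapMatrix (m := Fin 2)) hsurj
  have hfield : Nat.card (Matrix (Fin 2) (Fin 2) (ZMod p))ˣ = (p ^ 2 - 1) * (p ^ 2 - p) := by
    simpa [Fin.prod_univ_two, ZMod.card] using Matrix.card_GL_field (𝔽 := ZMod p) 2
  have hcard (m : ℕ) : Nat.card (Matrix (Fin 2) (Fin 2) (ZMod m)) = m ^ 4 := by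
    simp only [Matrix, Nat.card_fun, Nat.card_zmod, Nat.card_eq_fintype_card, Fintype.card_fin]
    ring
  rw [hfield, hcard, hcard] at h
  obtain ⟨k, rfl⟩ := Nat.exists_eq_succ_of_ne_zero hk.ne'
  obtain ⟨q, rfl⟩ := Nat.exists_eq_succ_of_ne_zero hp.ne_zero
  have h₁ : q.succ ^ 2 - 1 = q * (q + 2) := by rw [Nat.succ_eq_add_one]; ring_nf; omega
  have h₂ : q.succ ^ 2 - q.succ = (q + 1) * q := by
    rw [Nat.succ_eq_add_one, Nat.sub_eq_iff_eq_add (by nlinarith)]; ring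
  rw [h₁, h₂] at h
  rw [Nat.totient_prime_pow_succ hp]
  refine Nat.eq_of_mul_eq_mul_right (pow_pos hp.pos 4) ?_
  calc _ = _ * q.succ := mul_right_comm _ _ _
    _ = _ := by
      unfold Matrix.GeneralLinearGroup
      rw [h]
      simp only [Nat.succ_eq_add_one, Nat.add_sub_cancel]
      ring

theorem Matrix.GeneralLinearGroup.card_zmod_mul_prod_primeFactors (N : ℕ) (hN : 0 < N) :
    Nat.card (GL (Fin 2) (ZMod N)) * ∏ p ∈ N.primeFactors, p
      = (N.totient * N) ^ 2 * ∏ p ∈ N.primeFactors, (p + 1) := by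
  induction N using Nat.recOnPosPrimePosCoprime with
  | zero => exact absurd hN (lt_irrefl 0)
  | one =>
    have : Subsingleton (Matrix (Fin 2) (Fin 2) (ZMod 1)) :=
      inferInstanceAs (Subsingleton (Fin 2 → Fin 2 → Fin 1))
    simp
  | prime_pow p k hp hk =>
    simpa [Nat.primeFactors_prime_pow hk.ne' hp] using card_zmod_prime_pow hp hk
  | coprime a b ha hb hab iha ihb =>
    rw [card_zmod_mul _ hab, hab.primeFactors_mul, Finset.prod_union hab.disjoint_primeFactors,
      Finset.prod_union hab.disjoint_primeFactors, Nat.totient_mul hab, mul_mul_mul_comm,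
      iha (by omega), ihb (by omega)]
    ring

theorem card_splitCartanSubgroup (N : ℕ) [NeZero N] :
    Nat.card (SplitCartanSubgroup N) = N.totient ^ 2 := by
  have hunit (g : SplitCartanSubgroup N) : IsUnit (g.1.1 0 0) ∧ IsUnit (g.1.1 1 1) := by
    have hdet := (Matrix.isUnit_iff_isUnit_det g.1.1).mp g.1.isUnit
    have h : g.1.1 0 1 = 0 := g.2.1
    rwa [Matrix.det_fin_two, h, zero_mul, sub_zero, IsUnit.mul_iff] at hdet
  let e : SplitCartanSubgroup N ≃ (ZMod N)ˣ × (ZMod N)ˣ :=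
    { toFun := fun g => ((hunit g).1.unit, (hunit g).2.unit)
      invFun := fun u => ⟨⟨!![(u.1 : ZMod N), 0; 0, u.2],
        !![((u.1⁻¹ : (ZMod N)ˣ) : ZMod N), 0; 0, ((u.2⁻¹ : (ZMod N)ˣ) : ZMod N)],
        by simp [Matrix.one_fin_two], by simp [Matrix.one_fin_two]⟩, by
          constructor <;> simp⟩
      left_inv := fun g => by
        have h₁ : g.1.1 0 1 = 0 := g.2.1
        have h₂ : g.1.1 1 0 = 0 := g.2.2
        refine Subtype.ext (Units.ext ?_)
        ext i j
        fin_cases i <;> fin_cases j <;> simp [h₁, h₂]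
      right_inv := fun u => Prod.ext (Units.ext (by simp)) (Units.ext (by simp)) }
  rw [Nat.card_congr e, Nat.card_prod, Nat.card_eq_fintype_card, ZMod.card_units_eq_totient, sq]

/-- `[GL₂(ZMod N) : C(N)] · ∏_{p|N} p = N² · ∏_{p|N} (p + 1)`. -/
theorem index_split_cartan (N : ℕ) (hN : 0 < N) :
    (SplitCartanSubgroup N).index * ∏ p ∈ N.primeFactors, p
      = N ^ 2 * ∏ p ∈ N.primeFactors, (p + 1) := by
  have : NeZero N := ⟨hN.ne'⟩
  have h := Matrix.GeneralLinearGroup.card_zmod_mul_prod_primeFactors N hN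
  rw [← (SplitCartanSubgroup N).card_mul_index, card_splitCartanSubgroup] at h
  refine Nat.eq_of_mul_eq_mul_left (pow_pos (Nat.totient_pos.mpr hN) 2) ?_
  rw [← mul_assoc, h]
  ring
end

section
/- Let R be a (possibly noncommutative) ring, N a positive integer, and f : R →+* M₂(ZMod N) a surjective ring homomorphism whose kernel equals the set N•R = {N·x : x ∈ R}. Suppose γ ∈ R is such that f(γ) = diag(λ, μ) is a diagonal matrix with λ − μ a unit of ZMod N. Then the preimage under f of the set of diagonal matrices is exactly the set {m·1 + k·γ + N·x : m, k ∈ ℤ, x ∈ R}. (This is the paper's computation that for a split Cartan level structure S on a supersingular elliptic curve E and an endomorphism γ acting diagonally on the basis with distinct eigenvalues, the order End(E,S) equals ℤ[γ] + N·End(E).) -/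
/-- if `f : R →+* M₂(ZMod N)` is a surjective ring homomorphism with
kernel `N•R`, and `γ ∈ R` satisfies `f γ = diag(λ, μ)` with `λ − μ` a unit, then the
preimage of the diagonal matrices is `{m·1 + k·γ + N·x : m, k ∈ ℤ, x ∈ R}`.
(This computes `End(E,S) = ℤ[γ] + N·End(E)` for a split Cartan level structure.) -/
theorem preimage_diagonals_eq
    (R : Type*) [Ring R] (N : ℕ) (hN : 0 < N)
    (f : R →+* Matrix (Fin 2) (Fin 2) (ZMod N))
    (hsurj : Function.Surjective f)
    (hker : ∀ x : R, f x = 0 ↔ ∃ y : R, x = N • y)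
    (γ : R) (lam mu : ZMod N)
    (hγ : f γ = Matrix.diagonal ![lam, mu])
    (hunit : IsUnit (lam - mu)) :
    {x : R | ∃ s t : ZMod N, f x = Matrix.diagonal ![s, t]}
      = {x : R | ∃ (m k : ℤ) (y : R), x = (m : R) + (k : R) * γ + N • y} := by
  have hlin : ∀ m k : ℤ, f ((m : R) + (k : R) * γ)
      = Matrix.diagonal ![(m : ZMod N) + k * lam, (m : ZMod N) + k * mu] := by
    intro m k
    rw [map_add, map_mul, map_intCast, map_intCast, hγ, ← Matrix.diagonal_intCast,
      ← Matrix.diagonal_intCast, Matrix.diagonal_mul_diagonal, Matrix.diagonal_add]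
    congr 1
    ext i
    fin_cases i <;> simp
  ext x
  constructor
  · rintro ⟨s, t, hx⟩
    obtain ⟨v, hv⟩ := hunit.exists_right_inv
    obtain ⟨k, hk⟩ := ZMod.intCast_surjective ((s - t) * v)
    obtain ⟨m, hm⟩ := ZMod.intCast_surjective (s - (s - t) * v * lam)
    have hs : (m : ZMod N) + k * lam = s := by rw [hm, hk]; ring
    have ht : (m : ZMod N) + k * mu = t := by
      rw [hm, hk]
      linear_combination (t - s) * hv
    obtain ⟨y, hy⟩ := (hker (x - ((m : R) + (k : R) * γ))).mp (by
      rw [map_sub, hlin, hx, hs, ht, sub_self])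
    exact ⟨m, k, y, by rw [← hy]; abel⟩
  · rintro ⟨m, k, y, rfl⟩
    exact ⟨_, _, by rw [map_add, (hker (N • y)).mpr ⟨y, rfl⟩, add_zero, hlin]⟩
end
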